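/- Let G be the group with presentation ⟨γ₁, γ₂ ∣ (γ₁γ₂)³ = (γ₂γ₁)³⟩ (the Artin group of type I₂(6)). Then G is torsion free: the only element of G of finite order is the identity. -/

import Mathlib

/-- The single relation `(γ₁γ₂)³ = (γ₂γ₁)³` of the Artin group of type `I₂(6)`,
written as a relator in the free group on two generators. -/
def artinI26Rels : Set (FreeGroup (Fin 2)) :=
  {(FreeGroup.of 0 * FreeGroup.of 1) ^ 3 * ((FreeGroup.of 1 * FreeGroup.of 0) ^ 3)⁻¹}

namespace ArtinI26

/-- The action of `ℤ` on the free group on `ZMod 3` by cyclic shifts of the generators. -/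
def shift : Multiplicative ℤ →* MulAut (FreeGroup (ZMod 3)) where
  toFun n := FreeGroup.freeGroupCongr (Equiv.addLeft (n.toAdd : ZMod 3))
  map_one' := by
    apply MulEquiv.toMonoidHom_injective
    ext i
    simp
  map_mul' m n := by
    apply MulEquiv.toMonoidHom_injective
    ext i
    simp [add_assoc]

theorem shift_of (n : Multiplicative ℤ) (i : ZMod 3) :
    shift n (FreeGroup.of i) = FreeGroup.of ((n.toAdd : ZMod 3) + i) := by
  simp [shift]

/-- A semidirect product of torsion-free groups is torsion free. -/
theorem semidirectProduct_eq_one_of_pow_eq_one {N H : Type*} [Group N] [Group H]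
    [IsMulTorsionFree N] [IsMulTorsionFree H] {φ : H →* MulAut N} {g : N ⋊[φ] H} {k : ℕ}
    (hk : k ≠ 0) (hg : g ^ k = 1) : g = 1 := by
  have hright : g.right = 1 := by
    have h := congrArg SemidirectProduct.rightHom hg
    rw [map_pow, map_one, pow_eq_one_iff_left hk] at h
    exact h
  have hinl : g = SemidirectProduct.inl g.left := by
    ext <;> simp [hright]
  rw [hinl, ← map_pow, ← map_one (SemidirectProduct.inl (φ := φ)),
    SemidirectProduct.inl_inj, pow_eq_one_iff_left hk] at hg
  rw [hinl, hg, map_one]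

/-- Conjugates of `x` by powers of `c` depend only on the exponent modulo `3`
when `c ^ 3` commutes with `x`. -/
theorem zpow_conj_eq_of_zmod_eq {G : Type*} [Group G] {c x : G} (h : Commute (c ^ 3) x)
    {m n : ℤ} (hmn : (m : ZMod 3) = n) : c ^ m * x * c ^ (-m) = c ^ n * x * c ^ (-n) := by
  obtain ⟨l, hl⟩ := ((ZMod.intCast_eq_intCast_iff_dvd_sub n m 3).1 hmn.symm)
  obtain rfl : m = n + 3 * l := by push_cast at hl; lia
  have hcomm : c ^ (3 * l) * x = x * c ^ (3 * l) := by
    rw [zpow_mul]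
    exact_mod_cast (h.zpow_left l).eq
  rw [zpow_add, mul_assoc (c ^ n), hcomm, neg_add, add_comm (-n), zpow_add]
  simp [mul_assoc]

/-- The map to `F₃ ⋊ ℤ`, sending `γ₁` to a free generator and `γ₁γ₂` to the generator of `ℤ`. -/
def toSemidirect : PresentedGroup artinI26Rels →* FreeGroup (ZMod 3) ⋊[shift] Multiplicative ℤ :=
  PresentedGroup.toGroup
    (f := ![SemidirectProduct.inl (FreeGroup.of 0),
      (SemidirectProduct.inl (FreeGroup.of 0))⁻¹ * SemidirectProduct.inr (Multiplicative.ofAdd (1 : ℤ))])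
    (by
      rintro _ rfl
      have h3 : (1 + (1 + 1) : ZMod 3) = 0 := by decide
      rw [map_mul, map_inv, mul_inv_eq_one]
      ext <;> simp [pow_succ, shift_of, mul_assoc, h3])

local notation "γ₁" => (PresentedGroup.of 0 : PresentedGroup artinI26Rels)
local notation "γ₂" => (PresentedGroup.of 1 : PresentedGroup artinI26Rels)

theorem relation : (γ₁ * γ₂) ^ 3 = (γ₂ * γ₁) ^ 3 :=
  PresentedGroup.mk_eq_mk_of_mul_inv_mem (rels := artinI26Rels) rfl

theorem commute_pow_three : Commute ((γ₁ * γ₂) ^ 3) γ₁ := by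
  rw [Commute, SemiconjBy]
  conv_rhs => rw [relation]
  simp only [pow_succ, pow_zero, one_mul, mul_assoc]

/-- The inverse of `toSemidirect`. -/
def ofSemidirect : FreeGroup (ZMod 3) ⋊[shift] Multiplicative ℤ →* PresentedGroup artinI26Rels :=
  SemidirectProduct.lift
    (FreeGroup.lift fun i => (γ₁ * γ₂) ^ (i.val : ℤ) * γ₁ * (γ₁ * γ₂) ^ (-(i.val : ℤ)))
    (zpowersHom _ (γ₁ * γ₂)) (by
      intro n
      ext i
      have h : (((((n.toAdd : ZMod 3) + i).val : ℤ)) : ZMod 3) = ((n.toAdd + (i.val : ℤ) : ℤ)) := by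
        simp
      simp only [MonoidHom.comp_apply, MulEquiv.coe_toMonoidHom, shift_of, FreeGroup.lift_apply_of,
        MulAut.conj_apply, zpowersHom_apply]
      rw [zpow_conj_eq_of_zmod_eq commute_pow_three h, zpow_add, neg_add, add_comm (-_), zpow_add,
        zpow_neg _ (Multiplicative.toAdd n)]
      simp only [mul_assoc])

theorem ofSemidirect_comp_toSemidirect :
    ofSemidirect.comp toSemidirect = MonoidHom.id _ := by
  ext i
  fin_cases i <;> simp [ofSemidirect, toSemidirect]

end ArtinI26

/-- the group `G = ⟨γ₁, γ₂ ∣ (γ₁γ₂)³ = (γ₂γ₁)³⟩` is torsion free: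
the only element of finite order is the identity. -/
theorem stmt_10 (g : PresentedGroup artinI26Rels) (k : ℕ) (hk : 0 < k)
    (hg : g ^ k = 1) : g = 1 := by
  have h : ArtinI26.toSemidirect g = 1 :=
    ArtinI26.semidirectProduct_eq_one_of_pow_eq_one hk.ne' (by rw [← map_pow, hg, map_one])
  have hid := DFunLike.congr_fun ArtinI26.ofSemidirect_comp_toSemidirect g
  rw [MonoidHom.comp_apply, h, map_one] at hid
  exact hid.symm
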